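/- arXiv:1007.0665 — 2 statements merged into one kernel-verified Lean document; each statement's English description precedes it below -/
import Mathlib

section
/- Let N/F be a Galois extension of number fields of odd degree. Then for every nonzero prime ideal 𝔭 of 𝓞_N, the exponent of 𝔭 in the prime factorization of the different ideal 𝔇_{N/F} is even. -/
open NumberField
open scoped nonZeroDivisors Classical

/-- Given a maximal ideal `P` with finite residue field and `J` coprime to `P`, some `α ∈ J` generates
`(B ⧸ P)ˣ` and is such that `α ^ (m + 1) - 1` is a uniformizer at `P`, where `m + 1 = #(B ⧸ P)ˣ`. -/
theorem exists_local_generator {B : Type*} [CommRing B] [IsDedekindDomain B]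
    {P J : Ideal B} [P.IsMaximal] [Finite (B ⧸ P)] (hP : P ≠ ⊥) (hJ : IsCoprime P J) :
    ∃ α ∈ J, ∃ m : ℕ, α ^ (m + 1) - 1 ∈ P ∧ α ^ (m + 1) - 1 ∉ P ^ 2 ∧
      ∀ b, b ∈ P ∨ ∃ n : ℕ, b - α ^ n ∈ P := by
  let _ := Ideal.Quotient.field P
  obtain ⟨ζ, hζ⟩ := IsCyclic.exists_generator (α := (B ⧸ P)ˣ)
  obtain ⟨m, hm⟩ : ∃ m, Nat.card (B ⧸ P)ˣ = m + 1 := ⟨_, (Nat.succ_pred Nat.card_pos.ne').symm⟩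
  have hζm : ζ ^ (m + 1) = 1 := hm ▸ pow_card_eq_one'
  have hq : ((m + 2 : ℕ) : B) ∈ P := by
    rw [← Ideal.Quotient.eq_zero_iff_mem, map_natCast]
    have h2 : Nat.card (B ⧸ P) = m + 2 := by
      rw [Nat.card_eq_card_units_add_one, hm]
    rw [← h2]
    have := Fintype.ofFinite (B ⧸ P)
    rw [Nat.card_eq_fintype_card]
    exact Nat.cast_card_eq_zero _
  obtain ⟨β, hβ⟩ := Ideal.Quotient.mk_surjective (ζ : B ⧸ P)
  obtain ⟨π, hπ, hπ2⟩ : ∃ π ∈ P, π ∉ P ^ 2 := by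
    simpa using Ideal.exists_mem_pow_notMem_pow_succ P hP (Ideal.IsPrime.ne_top inferInstance) 1
  obtain ⟨γ, hγ, hγ2⟩ : ∃ γ, Ideal.Quotient.mk P γ = ζ ∧ γ ^ (m + 2) - γ ∉ P ^ 2 := by
    by_cases h : β ^ (m + 2) - β ∈ P ^ 2
    · refine ⟨β + π, by rw [map_add, hβ, Ideal.Quotient.eq_zero_iff_mem.mpr hπ, add_zero],
        fun h' ↦ hπ2 ?_⟩
      obtain ⟨k, hk⟩ := Polynomial.powAddExpansion β π (m + 2)
      have hππ : k * π ^ 2 ∈ P ^ 2 := Ideal.mul_mem_left _ _ (Ideal.pow_mem_pow hπ 2)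
      have hqπ : β ^ (m + 1) * (((m + 2 : ℕ) : B) * π) ∈ P ^ 2 :=
        Ideal.mul_mem_left _ _ (pow_two P ▸ Ideal.mul_mem_mul hq hπ)
      have : π = (β ^ (m + 2) - β) + β ^ (m + 1) * (((m + 2 : ℕ) : B) * π) + k * π ^ 2 -
          ((β + π) ^ (m + 2) - (β + π)) := by
        rw [hk, show m + 2 - 1 = m + 1 from rfl]
        ring
      rw [this]
      exact sub_mem (add_mem (add_mem h hqπ) hππ) h'
    · exact ⟨β, hβ, h⟩
  obtain ⟨α, hα, hαJ⟩ : ∃ α, α - γ ∈ P ^ 2 ∧ α ∈ J := by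
    obtain ⟨x, hx, y, hy, hxy⟩ := Ideal.isCoprime_iff_exists.mp (hJ.pow_left (m := 2))
    refine ⟨y * γ, ?_, J.mul_mem_right _ hy⟩
    have : y * γ - γ = - γ * x := by linear_combination γ * hxy
    exact this ▸ Ideal.mul_mem_left _ _ hx
  have hαζ : Ideal.Quotient.mk P α = ζ := by
    rw [← hγ, Ideal.Quotient.eq]
    exact Ideal.pow_le_self two_ne_zero hα
  refine ⟨α, hαJ, m, ?_, fun h ↦ hγ2 ?_, fun b ↦ ?_⟩
  · rw [← Ideal.Quotient.eq_zero_iff_mem]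
    simp [hαζ, ← Units.val_pow_eq_pow_val, hζm]
  · rw [← Ideal.Quotient.eq] at hα
    rw [← Ideal.Quotient.eq_zero_iff_mem] at h ⊢
    have : γ ^ (m + 2) - γ = γ * (γ ^ (m + 1) - 1) := by ring
    rw [this]
    simp only [map_sub, map_pow, map_mul, hα] at h ⊢
    rw [h, mul_zero]
  · by_cases hb : b ∈ P
    · exact .inl hb
    · right
      have hb0 : Ideal.Quotient.mk P b ≠ 0 := by rwa [Ne, Ideal.Quotient.eq_zero_iff_mem]
      obtain ⟨n, hn⟩ := mem_powers_iff_mem_zpowers.mpr (hζ (Units.mk0 _ hb0))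
      refine ⟨n, ?_⟩
      rw [← Ideal.Quotient.eq, map_pow, hαζ]
      simpa using (congrArg Units.val hn).symm

/-- An element as in `exists_local_generator`, with `J` the prime-to-`P` part of an ideal extended
from `A`, has conductor prime to `P`. -/
theorem not_conductor_le {A B : Type*} [CommRing A] [CommRing B] [IsDedekindDomain B]
    [Algebra A B] [Module.Finite A B] {p : Ideal A} {P J : Ideal B} [P.IsMaximal] (hP : P ≠ ⊥)
    {e : ℕ} (he : e ≠ 0) (hp : p.map (algebraMap A B) = P ^ e * J)
    {α : B} (hαJ : α ∈ J) {m : ℕ} (h1 : α ^ (m + 1) - 1 ∈ P) (h2 : α ^ (m + 1) - 1 ∉ P ^ 2)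
    (hα : ∀ b, b ∈ P ∨ ∃ n : ℕ, b - α ^ n ∈ P) : ¬ conductor A α ≤ P := by
  let C := Algebra.adjoin A {α}
  let Q : Ideal C := P.comap (algebraMap C B)
  have hαC : α ∈ C := Algebra.self_mem_adjoin_singleton A α
  have hpP : p.map (algebraMap A B) ≤ P :=
    hp.trans_le <| Ideal.mul_le_left.trans (Ideal.pow_le_self he)
  have hQ : P ≤ Q.map (algebraMap C B) := by
    set I := Q.map (algebraMap C B)
    have hu : α ^ (m + 1) - 1 ∈ I :=
      Ideal.mem_map_of_mem (algebraMap C B)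
        (x := ⟨α ^ (m + 1) - 1, sub_mem (pow_mem hαC _) (one_mem C)⟩) h1
    have hpI : P ^ e * J ≤ I := by
      rw [← hp, Ideal.map_le_iff_le_comap]
      intro x hx
      exact Ideal.mem_map_of_mem (algebraMap C B) (x := algebraMap A C x)
        (hpP (Ideal.mem_map_of_mem _ hx))
    have hIJ : J ⊔ I = ⊤ := by
      rw [Ideal.eq_top_iff_one]
      have : (1 : B) = α ^ (m + 1) + -(α ^ (m + 1) - 1) := by ring
      rw [this]
      exact add_mem (Ideal.mem_sup_left (Ideal.pow_mem_of_mem _ hαJ _ m.succ_pos))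
        (Ideal.mem_sup_right (neg_mem hu))
    have hI0 : I ≠ ⊥ := fun h ↦ h2 (by
      rw [h, Ideal.mem_bot] at hu; rw [hu]; exact zero_mem _)
    have hPe : P ^ e ⊔ I = P ^ min ((UniqueFactorizationMonoid.normalizedFactors I).count P) e :=
      Ideal.irreducible_pow_sup hI0 (Ideal.prime_of_isPrime hP inferInstance).irreducible e
    have hle : P ≤ P ^ e ⊔ I := by
      rw [hPe]
      set k := min ((UniqueFactorizationMonoid.normalizedFactors I).count P) e
      have hk : k < 2 := by
        by_contra! hk
        exact h2 (Ideal.pow_le_pow_right hk (hPe ▸ Ideal.mem_sup_right hu))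
      calc P = P ^ 1 := (pow_one P).symm
        _ ≤ P ^ k := Ideal.pow_le_pow_right (by omega)
    calc P ≤ (P ^ e ⊔ I) * (J ⊔ I) := by rwa [hIJ, Ideal.mul_top]
      _ ≤ I := by
        rw [Ideal.sup_mul, Ideal.mul_sup]
        exact sup_le (sup_le hpI Ideal.mul_le_right) Ideal.mul_le_left
  let S : Submodule C B := LinearMap.range (Algebra.linearMap C B)
  have : Module.Finite C B := Module.Finite.of_restrictScalars_finite A C B
  have htop : (⊤ : Submodule C (B ⧸ S)) ≤ Q • ⊤ := by
    rintro x -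
    obtain ⟨b, rfl⟩ := S.mkQ_surjective x
    obtain ⟨c, hc⟩ : ∃ c : C, b - algebraMap C B c ∈ P := by
      rcases hα b with h | ⟨n, h⟩
      · exact ⟨0, by simpa using h⟩
      · exact ⟨⟨α ^ n, pow_mem hαC n⟩, h⟩
    have hz : b - algebraMap C B c ∈ Q • (⊤ : Submodule C B) := by
      rw [Ideal.smul_top_eq_map]
      exact hQ hc
    have hb : S.mkQ b = S.mkQ (b - algebraMap C B c) := by
      rw [← sub_eq_zero, ← map_sub, sub_sub_cancel]
      simp only [Submodule.mkQ_apply, Submodule.Quotient.mk_eq_zero]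
      exact ⟨c, rfl⟩
    rw [hb]
    have := Submodule.mem_map_of_mem (f := S.mkQ) hz
    rw [Submodule.map_smul''] at this
    exact Submodule.smul_mono le_rfl le_top this
  obtain ⟨r, hr, hr'⟩ := Submodule.exists_sub_one_mem_and_smul_eq_zero_of_fg_of_le_smul Q
    (⊤ : Submodule C (B ⧸ S)) Module.Finite.fg_top htop
  intro hle
  have hrP : (r : B) ∈ P := hle (mem_conductor_iff.mpr fun b ↦ by
    have h := hr' (S.mkQ b) trivial
    rw [← map_smul, Submodule.mkQ_apply, Submodule.Quotient.mk_eq_zero] at h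
    obtain ⟨c, hc⟩ := h
    have hc' : (c : B) = r * b := hc
    exact hc' ▸ c.2)
  have hr1 : (r : B) - 1 ∈ P := hr
  exact Ideal.IsPrime.one_notMem (I := P) inferInstance
    (by simpa using sub_mem hrP hr1)

theorem adjoin_eq_top_of_conductor_ne_bot {A B K L : Type*} [CommRing A] [CommRing B] [Field K]
    [Field L] [Algebra A B] [Algebra A K] [Algebra A L] [Algebra K L] [Algebra B L]
    [IsScalarTower A B L] [IsScalarTower A K L] [IsFractionRing B L] [Algebra.IsAlgebraic K L]
    {α : B} (h : conductor A α ≠ ⊥) : Algebra.adjoin K {algebraMap B L α} = ⊤ := by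
  have hmem (x : B) (hx : x ∈ Algebra.adjoin A {α}) :
      algebraMap B L x ∈ Algebra.adjoin K {algebraMap B L α} := by
    induction hx using Algebra.adjoin_induction with
    | mem x hx =>
      rw [Set.mem_singleton_iff] at hx
      exact hx ▸ Algebra.self_mem_adjoin_singleton K _
    | algebraMap r =>
      rw [← IsScalarTower.algebraMap_apply A B L, IsScalarTower.algebraMap_apply A K L]
      exact Subalgebra.algebraMap_mem _ _
    | add x y _ _ hx hy => simpa using add_mem hx hy
    | mul x y _ _ hx hy => simpa using mul_mem hx hy
  obtain ⟨s, hs, hs0⟩ := Submodule.exists_mem_ne_zero_of_ne_bot h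
  rw [eq_top_iff]
  rintro x -
  obtain ⟨a, b, hb, rfl⟩ := IsFractionRing.div_surjective (A := B) x
  have hs0' : algebraMap B L s ≠ 0 := by
    simpa using (IsFractionRing.injective B L).ne hs0
  rw [← mul_div_mul_left _ _ hs0', ← map_mul, ← map_mul, div_eq_mul_inv]
  refine mul_mem (hmem _ (hs a)) ?_
  exact Subalgebra.inv_mem_of_algebraic _ (x := ⟨_, hmem _ (hs b)⟩)
    (Algebra.IsAlgebraic.isAlgebraic _)

open Polynomial in
theorem aeval_derivative_minpoly_eq_prod {K L : Type*} [Field K] [Field L] [Algebra K L]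
    [FiniteDimensional K L] [IsGalois K L] {x : L} (hx : Algebra.adjoin K {x} = ⊤) :
    aeval x (derivative (minpoly K x)) =
      ∏ σ ∈ Finset.univ.erase (1 : L ≃ₐ[K] L), (x - σ x) := by
  have hinj : Function.Injective fun σ : L ≃ₐ[K] L ↦ σ x := by
    intro σ τ h
    have : (σ : L →ₐ[K] L) = τ := AlgHom.ext_of_adjoin_eq_top hx (by simpa using h)
    exact AlgEquiv.ext fun y ↦ DFunLike.congr_fun this y
  have hprim : IntermediateField.adjoin K {x} = ⊤ := by
    rw [eq_top_iff, ← IntermediateField.toSubalgebra_le_toSubalgebra,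
      IntermediateField.top_toSubalgebra, ← hx]
    exact IntermediateField.algebra_adjoin_le_adjoin K {x}
  have hmin : (minpoly K x).map (algebraMap K L) = ∏ σ : L ≃ₐ[K] L, (X - C (σ x)) := by
    refine eq_of_monic_of_dvd_of_natDegree_le (monic_prod_of_monic _ _ fun σ _ ↦ monic_X_sub_C _)
      ((minpoly.monic (IsIntegral.of_finite K x)).map _) ?_ ?_
    · refine Finset.prod_dvd_of_coprime
        (fun σ _ τ _ h ↦ pairwise_coprime_X_sub_C hinj h) fun σ _ ↦ ?_
      rw [dvd_iff_isRoot, IsRoot.def, eval_map_algebraMap, aeval_algHom_apply, minpoly.aeval, map_zero]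
    · rw [natDegree_map, (Field.primitive_element_iff_minpoly_natDegree_eq K x).mp hprim,
        natDegree_prod_of_monic _ _ fun σ _ ↦ monic_X_sub_C _]
      simp [← IsGalois.card_aut_eq_finrank, Nat.card_eq_fintype_card]
  rw [← eval_map_algebraMap, ← derivative_map, hmin, derivative_prod_finset, eval_finsetSum,
    Finset.sum_eq_single_of_mem 1 (Finset.mem_univ _)]
  · simp [eval_prod]
  · intro σ _ hσ
    rw [eval_mul, eval_prod, Finset.prod_eq_zero (i := 1) (by simp [hσ.symm]) (by simp), zero_mul]

open UniqueFactorizationMonoid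

theorem count_normalizedFactors_span_prod {B ι : Type*} [CommRing B] [IsDedekindDomain B]
    (P : Ideal B) (s : Finset ι) (f : ι → B) (hf : ∀ i ∈ s, f i ≠ 0) :
    (normalizedFactors (Ideal.span {∏ i ∈ s, f i})).count P =
      ∑ i ∈ s, (normalizedFactors (Ideal.span {f i})).count P := by
  induction s using Finset.induction_on with
  | empty => simp [Ideal.span_singleton_one, ← Ideal.one_eq_top]
  | insert a s ha ih =>
    rw [Finset.forall_mem_insert] at hf
    rw [Finset.prod_insert ha, Finset.sum_insert ha, ← Ideal.span_singleton_mul_span_singleton,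
      normalizedFactors_mul (by simpa using hf.1)
        (by simpa [Finset.prod_eq_zero_iff] using hf.2), Multiset.count_add, ih hf.2]

theorem count_normalizedFactors_span_congr {B : Type*} [CommRing B] [IsDedekindDomain B]
    {P : Ideal B} [P.IsPrime] (hP : P ≠ ⊥) {x y : B} (hx : x ≠ 0) (hy : y ≠ 0)
    (h : ∀ n, x ∈ P ^ n ↔ y ∈ P ^ n) :
    (normalizedFactors (Ideal.span {x})).count P =
      (normalizedFactors (Ideal.span {y})).count P := by
  have hirr : Irreducible P := (Ideal.prime_of_isPrime hP inferInstance).irreducible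
  have : emultiplicity P (Ideal.span {x}) = emultiplicity P (Ideal.span {y}) := by
    rw [emultiplicity_eq_emultiplicity_iff]
    simpa [Ideal.dvd_span_singleton] using h
  rw [emultiplicity_eq_count_normalizedFactors hirr (by simpa using hx),
    emultiplicity_eq_count_normalizedFactors hirr (by simpa using hy), normalize_eq] at this
  exact_mod_cast this

theorem even_sum_erase_one_of_odd_card {G : Type*} [Group G] [Fintype G]
    (hG : Odd (Fintype.card G)) (f : G → ℕ) (hf : ∀ g, f g⁻¹ = f g) :
    Even (∑ g ∈ Finset.univ.erase 1, f g) := by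
  rw [← ZMod.natCast_eq_zero_iff_even, Nat.cast_sum]
  refine Finset.sum_involution (fun g _ ↦ g⁻¹) (fun g _ ↦ ?_) (fun g hg _ h ↦ ?_)
    (fun g hg ↦ by simpa using hg) (fun g _ ↦ inv_inv g)
  · rw [hf, CharTwo.add_self_eq_zero]
  · refine Finset.ne_of_mem_erase hg ?_
    have h2 : g ^ 2 = 1 := by rw [pow_two, ← inv_eq_iff_mul_eq_one, h]
    rw [← orderOf_eq_one_iff]
    exact Nat.eq_one_of_dvd_coprimes (hG.coprime_two_right) (orderOf_dvd_card)
      (orderOf_dvd_of_pow_eq_one h2)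

/-- For an odd degree Galois extension `N/F` of number fields, the exponent of any
nonzero prime ideal `𝔭` of `𝓞 N` in the prime factorization of the different ideal
`𝔇_{N/F}` is even. -/
theorem even_count_normalizedFactors_differentIdeal
    (F N : Type*) [Field F] [Field N] [NumberField F] [NumberField N]
    [Algebra F N] [IsGalois F N] (hodd : Odd (Module.finrank F N))
    (𝔭 : Ideal (𝓞 N)) (hprime : 𝔭.IsPrime) (hbot : 𝔭 ≠ ⊥) :
    Even (Multiset.count 𝔭
      (UniqueFactorizationMonoid.normalizedFactors (differentIdeal (𝓞 F) (𝓞 N)))) := by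
  have hmax : 𝔭.IsMaximal := hprime.isMaximal hbot
  have : Finite (𝓞 N ⧸ 𝔭) := Ideal.finiteQuotientOfFreeOfNeBot 𝔭 hbot
  have hpr : Prime 𝔭 := Ideal.prime_of_isPrime hbot hprime
  set p := 𝔭.under (𝓞 F)
  have hp0 : p.map (algebraMap (𝓞 F) (𝓞 N)) ≠ ⊥ :=
    Ideal.map_ne_bot_of_ne_bot (Ideal.under_ne_bot _ hbot)
  obtain ⟨e, J, hJ, hpJ⟩ := WfDvdMonoid.max_power_factor hp0 hpr.irreducible
  have hp𝔭 : p.map (algebraMap (𝓞 F) (𝓞 N)) ≤ 𝔭 := Ideal.map_comap_le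
  have he : e ≠ 0 := by
    rintro rfl
    rw [pow_zero, one_mul] at hpJ
    exact hJ (hpJ ▸ Ideal.dvd_iff_le.mpr hp𝔭)
  have hcop : IsCoprime 𝔭 J := by
    rw [Ideal.isCoprime_iff_sup_eq]
    by_contra hne
    exact hJ (Ideal.dvd_iff_le.mpr (hmax.eq_of_le hne le_sup_left ▸ le_sup_right))
  obtain ⟨α, hαJ, m, h1, h2, h3⟩ := exists_local_generator hbot hcop
  have hcond := not_conductor_le hbot he hpJ hαJ h1 h2 h3
  have hα𝔭 : α ∉ 𝔭 := fun h ↦ Ideal.IsPrime.one_notMem hprime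
    (by simpa using sub_mem (𝔭.pow_mem_of_mem h (m + 1) m.succ_pos) h1)
  have hgen : Algebra.adjoin F {algebraMap (𝓞 N) N α} = ⊤ :=
    adjoin_eq_top_of_conductor_ne_bot (A := 𝓞 F) fun h ↦ hcond (h ▸ bot_le)
  let ρ := galRestrict (𝓞 F) F N (𝓞 N)
  have hfix (σ : N ≃ₐ[F] N) (hσ : σ ≠ 1) : α - ρ σ α ≠ 0 := by
    intro h
    refine hσ (AlgEquiv.ext fun y ↦ ?_)
    have : (σ : N →ₐ[F] N) = AlgHom.id F N := AlgHom.ext_of_adjoin_eq_top hgen (by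
      simpa [ρ, algebraMap_galRestrict_apply] using
        congrArg (algebraMap (𝓞 N) N) (sub_eq_zero.mp h).symm)
    exact DFunLike.congr_fun this y
  have hprod : Polynomial.aeval α (Polynomial.derivative (minpoly (𝓞 F) α)) =
      ∏ σ ∈ Finset.univ.erase (1 : N ≃ₐ[F] N), (α - ρ σ α) := by
    apply FaithfulSMul.algebraMap_injective (𝓞 N) N
    rw [map_prod, ← Polynomial.aeval_algebraMap_apply,
      ← Polynomial.aeval_map_algebraMap F, ← Polynomial.derivative_map,
      ← minpoly.isIntegrallyClosed_eq_field_fractions F N (IsIntegral.of_finite (𝓞 F) α),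
      aeval_derivative_minpoly_eq_prod hgen]
    simp [ρ, algebraMap_galRestrict_apply]
  have hmul := conductor_mul_differentIdeal (𝓞 F) F N α hgen
  have hcount : (normalizedFactors (differentIdeal (𝓞 F) (𝓞 N))).count 𝔭 =
      ∑ σ ∈ Finset.univ.erase (1 : N ≃ₐ[F] N),
        (normalizedFactors (Ideal.span {α - ρ σ α})).count 𝔭 := by
    rw [← count_normalizedFactors_span_prod _ _ _ fun σ hσ ↦ hfix σ (Finset.ne_of_mem_erase hσ),
      ← hprod, ← hmul, normalizedFactors_mul (fun h ↦ hcond (h.trans_le bot_le))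
        differentIdeal_ne_bot, Multiset.count_add,
      right_eq_add, Multiset.count_eq_zero]
    exact fun h ↦ hcond (Ideal.le_of_dvd (dvd_of_mem_normalizedFactors h))
  rw [hcount]
  refine even_sum_erase_one_of_odd_card
    (by rwa [← Nat.card_eq_fintype_card, IsGalois.card_aut_eq_finrank]) _ fun σ ↦ ?_
  rcases eq_or_ne σ 1 with rfl | hσ
  · simp
  refine count_normalizedFactors_span_congr hbot (hfix _ (inv_ne_one.mpr hσ)) (hfix _ hσ) ?_
  have hstab (τ : N ≃ₐ[F] N) (hτ : 𝔭.comap (ρ τ) = 𝔭) : 𝔭.comap (ρ τ⁻¹) = 𝔭 := by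
    ext x
    conv_lhs => rw [← hτ]
    rw [Ideal.mem_comap, Ideal.mem_comap, ← AlgEquiv.mul_apply, ← map_mul, mul_inv_cancel,
      map_one, AlgEquiv.one_apply]
  have hmem_pow (τ : N ≃ₐ[F] N) (hτ : 𝔭.comap (ρ τ) = 𝔭) (n : ℕ) (h : α - ρ τ⁻¹ α ∈ 𝔭 ^ n) :
      α - ρ τ α ∈ 𝔭 ^ n := by
    have hle : (𝔭 ^ n).map (ρ τ) ≤ 𝔭 ^ n := by
      rw [Ideal.map_pow]
      exact Ideal.pow_right_mono (Ideal.map_le_iff_le_comap.mpr hτ.ge) n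
    have := neg_mem (hle (Ideal.mem_map_of_mem (ρ τ) h))
    rwa [map_sub, ← AlgEquiv.mul_apply, ← map_mul, mul_inv_cancel, map_one, AlgEquiv.one_apply,
      neg_sub] at this
  have hnotMem (τ : N ≃ₐ[F] N) (hτ : 𝔭.comap (ρ τ) ≠ 𝔭) : α - ρ τ α ∉ 𝔭 := by
    have hle : 𝔭 ^ e * J ≤ 𝔭.comap (ρ τ) := by
      rw [← hpJ, Ideal.map_le_iff_le_comap]
      intro x hx
      rw [Ideal.mem_comap, Ideal.mem_comap, AlgEquiv.commutes]
      exact hx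
    have hprime' : (𝔭.comap (ρ τ)).IsPrime := Ideal.comap_isPrime _ _
    rcases hprime'.mul_le.mp hle with h | h
    · exact absurd (hmax.eq_of_le hprime'.ne_top (hprime'.le_of_pow_le h)).symm hτ
    · exact fun h' ↦ hα𝔭 (by simpa using add_mem h' (h hαJ))
  intro n
  by_cases hσ𝔭 : 𝔭.comap (ρ σ) = 𝔭
  · exact ⟨hmem_pow σ hσ𝔭 n, fun h ↦ hmem_pow σ⁻¹ (hstab σ hσ𝔭) n (by rwa [inv_inv])⟩
  · have hσ𝔭' : 𝔭.comap (ρ σ⁻¹) ≠ 𝔭 := fun h ↦ hσ𝔭 (by simpa using hstab _ h)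
    rcases eq_or_ne n 0 with rfl | hn
    · simp
    · exact iff_of_false (fun h ↦ hnotMem _ hσ𝔭' (Ideal.pow_le_self hn h))
        fun h ↦ hnotMem _ hσ𝔭 (Ideal.pow_le_self hn h)
end

section
/- The value E_γ(1) = Σ_{n≥0} e_n of Dwork's power series at 1 exists (the family (e_n)_{n≥0} is summable) and is a primitive p-th root of unity in L. -/
/-- The `n`-th coefficient `e n` of Dwork's exponential power series
`E_γ(X) = exp(γ X − γ X^p) = Σ_{n ≥ 0} e_n X^n`, the formal power series obtained by
substituting the constant-term-zero series `γ X − γ X^p` into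
`exp(X) = Σ_{n ≥ 0} X^n / n!`.  Expanding `exp(γ X) · exp(−γ X^p)` gives the explicit
convolution formula `e_n = Σ_{i + p·j = n} (γ^i / i!) · ((−γ)^j / j!)`. -/
noncomputable def dworkCoeff (L : Type*) [Field L] (p : ℕ) (γ : L) (n : ℕ) : L :=
  ∑ j ∈ Finset.range (n / p + 1),
    (γ ^ (n - p * j) / ((n - p * j).factorial : L)) * ((-γ) ^ j / (j.factorial : L))

open PowerSeries in
/-- Dwork's exponential series `exp(γX) · exp(-γX^p)` as a formal power series. -/
noncomputable def dworkSeries {L : Type*} [Field L] [Algebra ℚ L] {p : ℕ} (hp : p ≠ 0) (γ : L) :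
    PowerSeries L :=
  rescale γ (exp L) * expand p hp (rescale (-γ) (exp L))

section Formal

open PowerSeries

variable {L : Type*} [Field L] [Algebra ℚ L] {p : ℕ} (γ : L)

lemma coeff_rescale_exp (n : ℕ) : coeff n (rescale γ (exp L)) = γ ^ n / (n.factorial : L) := by
  simp [coeff_exp, div_eq_mul_inv]

lemma derivative_rescale_exp : d⁄dX L (rescale γ (exp L)) = C γ * rescale γ (exp L) := by
  have := algebraRat.charZero L
  ext n
  rw [coeff_derivative, coeff_C_mul, coeff_rescale_exp, coeff_rescale_exp, Nat.factorial_succ]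
  have h1 : (n.factorial : L) ≠ 0 := Nat.cast_ne_zero.2 n.factorial_ne_zero
  have h2 : (n : L) + 1 ≠ 0 := Nat.cast_add_one_ne_zero n
  push_cast
  field_simp
  ring

lemma derivative_expand_rescale_exp (hp : p ≠ 0) :
    d⁄dX L (expand p hp (rescale γ (exp L))) =
      C (p * γ) * (X ^ (p - 1) * expand p hp (rescale γ (exp L))) := by
  have := algebraRat.charZero L
  ext n
  rw [coeff_derivative, coeff_C_mul, coeff_X_pow_mul', coeff_expand, coeff_expand]
  by_cases hn : p ∣ n + 1
  · obtain ⟨k, hk⟩ := hn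
    obtain ⟨k, rfl⟩ : ∃ j, k = j + 1 := Nat.exists_eq_succ_of_ne_zero (by rintro rfl; simp at hk)
    have hle : p - 1 ≤ n := by
      have : p ≤ p * (k + 1) := Nat.le_mul_of_pos_right p k.succ_pos
      omega
    have hsub : n - (p - 1) = p * k := by
      rw [mul_add] at hk
      omega
    have hcast : (n : L) + 1 = p * (k + 1) := by exact_mod_cast hk
    rw [hk, hsub, if_pos (dvd_mul_right _ _), if_pos hle, if_pos (dvd_mul_right _ _),
      Nat.mul_div_cancel_left _ (Nat.pos_of_ne_zero hp),
      Nat.mul_div_cancel_left _ (Nat.pos_of_ne_zero hp), coeff_rescale_exp, coeff_rescale_exp,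
      Nat.factorial_succ, hcast]
    have h1 : (k.factorial : L) ≠ 0 := Nat.cast_ne_zero.2 k.factorial_ne_zero
    have h2 : (k : L) + 1 ≠ 0 := Nat.cast_add_one_ne_zero k
    push_cast
    field_simp
    ring
  · have hn' : p - 1 ≤ n → ¬ p ∣ n - (p - 1) := fun hle h ↦ hn <| by
      have : n + 1 = n - (p - 1) + p := by omega
      rw [this]
      exact dvd_add h dvd_rfl
    rw [if_neg hn]
    split_ifs with h1 h2
    · exact absurd h2 (hn' h1)
    · simp
    · simp

lemma coeff_dworkSeries (hp : p ≠ 0) (n : ℕ) : coeff n (dworkSeries hp γ) = dworkCoeff L p γ n := by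
  have hp' : 0 < p := Nat.pos_of_ne_zero hp
  rw [dworkSeries, coeff_mul, dworkCoeff]
  symm
  refine Finset.sum_of_injOn (fun j ↦ (n - p * j, p * j)) ?_ ?_ ?_ ?_
  · intro i _ j _ hij
    exact Nat.eq_of_mul_eq_mul_left hp' (Prod.ext_iff.1 hij).2
  · intro j hj
    have hj' : p * j ≤ n := by
      rw [mul_comm]
      exact (Nat.le_div_iff_mul_le hp').1 (Nat.lt_succ_iff.1 (Finset.mem_range.1 hj))
    simp [hj']
  · rintro ⟨a, b⟩ hab hnot
    rw [coeff_expand]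
    split_ifs with hdvd
    · obtain ⟨j, rfl⟩ := hdvd
      refine absurd ⟨j, ?_, ?_⟩ hnot
      · rw [Finset.mem_coe, Finset.mem_range, Nat.lt_succ_iff, Nat.le_div_iff_mul_le hp', mul_comm]
        have := Finset.HasAntidiagonal.mem_antidiagonal.1 hab
        grind
      · have := Finset.HasAntidiagonal.mem_antidiagonal.1 hab
        ext <;> grind
    · simp
  · intro j _
    rw [coeff_expand, if_pos (dvd_mul_right _ _), Nat.mul_div_cancel_left _ hp',
      coeff_rescale_exp, coeff_rescale_exp]

lemma dworkCoeff_succ (hp : p ≠ 0) (n : ℕ) :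
    (n + 1 : L) * dworkCoeff L p γ (n + 1) =
      γ * dworkCoeff L p γ n -
        p * γ * (if p - 1 ≤ n then dworkCoeff L p γ (n - (p - 1)) else 0) := by
  have h : d⁄dX L (dworkSeries hp γ) =
      C γ * dworkSeries hp γ - C (p * γ) * (X ^ (p - 1) * dworkSeries hp γ) := by
    rw [dworkSeries, Derivation.leibniz, derivative_rescale_exp, derivative_expand_rescale_exp _ hp,
      mul_neg, map_neg, smul_eq_mul, smul_eq_mul]
    ring
  have := congrArg (coeff n) h
  rw [coeff_derivative, map_sub, coeff_C_mul, coeff_C_mul, coeff_X_pow_mul'] at this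
  simp only [coeff_dworkSeries _ hp] at this
  rw [mul_comm, this]

lemma dworkSeries_pow (hp : p ≠ 0) :
    dworkSeries hp γ ^ p =
      rescale (p * γ) (exp L) * expand p hp (rescale (-(p * γ)) (exp L)) := by
  have h (a : L) : rescale a (exp L) ^ p = rescale (p * a) (exp L) := by
    rw [← map_pow, exp_pow_eq_rescale_exp, rescale_rescale]
  rw [dworkSeries, mul_pow, ← map_pow (expand p hp), h, h, mul_neg]

end Formal

section Values

open PowerSeries

variable {R : Type*} [NormedCommRing R] {f g : PowerSeries R}

lemma summable_norm_coeff_mul (hf : Summable fun n ↦ ‖coeff n f‖)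
    (hg : Summable fun n ↦ ‖coeff n g‖) : Summable fun n ↦ ‖coeff n (f * g)‖ := by
  simpa only [coeff_mul] using summable_norm_sum_mul_antidiagonal_of_summable_norm hf hg

lemma tsum_coeff_mul [CompleteSpace R] (hf : Summable fun n ↦ ‖coeff n f‖)
    (hg : Summable fun n ↦ ‖coeff n g‖) :
    ∑' n, coeff n (f * g) = (∑' n, coeff n f) * ∑' n, coeff n g := by
  simpa only [coeff_mul] using (tsum_mul_tsum_eq_tsum_sum_antidiagonal_of_summable_norm hf hg).symm

lemma summable_norm_coeff_one : Summable fun n ↦ ‖coeff n (1 : PowerSeries R)‖ :=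
  summable_of_ne_finset_zero (s := {0}) fun n hn ↦ by
    rw [coeff_one, if_neg (by simpa using hn), norm_zero]

lemma tsum_coeff_one : ∑' n, coeff n (1 : PowerSeries R) = 1 := by
  simp only [coeff_one, tsum_ite_eq]

lemma summable_norm_coeff_pow (hf : Summable fun n ↦ ‖coeff n f‖) (k : ℕ) :
    Summable fun n ↦ ‖coeff n (f ^ k)‖ := by
  induction k with
  | zero => simpa only [pow_zero] using summable_norm_coeff_one
  | succ k ih => simpa only [pow_succ] using summable_norm_coeff_mul ih hf

lemma tsum_coeff_pow [CompleteSpace R] (hf : Summable fun n ↦ ‖coeff n f‖) (k : ℕ) :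
    ∑' n, coeff n (f ^ k) = (∑' n, coeff n f) ^ k := by
  induction k with
  | zero => simpa only [pow_zero] using tsum_coeff_one
  | succ k ih => rw [pow_succ, pow_succ, tsum_coeff_mul (summable_norm_coeff_pow hf k) hf, ih]

lemma summable_norm_coeff_expand (hf : Summable fun n ↦ ‖coeff n f‖) {p : ℕ} (hp : p ≠ 0) :
    Summable fun n ↦ ‖coeff n (expand p hp f)‖ := by
  rw [← (mul_right_injective₀ hp).summable_iff]
  · simpa only [Function.comp_def, coeff_expand_mul] using hf
  · intro n hn
    rw [coeff_expand_of_not_dvd, norm_zero]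
    rintro ⟨k, rfl⟩
    exact hn ⟨k, rfl⟩

lemma tsum_coeff_expand {p : ℕ} (hp : p ≠ 0) :
    ∑' n, coeff n (expand p hp f) = ∑' n, coeff n f := by
  rw [← (mul_right_injective₀ hp).tsum_eq]
  · simp only [coeff_expand_mul]
  · intro n hn
    by_contra h
    refine hn (coeff_expand_of_not_dvd p hp f ?_)
    rintro ⟨k, rfl⟩
    exact h ⟨k, rfl⟩

end Values

section Estimates

variable {p : ℕ} [Fact p.Prime] {L : Type*} [NormedField L]

lemma charZero_of_norm_natCast (hL : ∀ k : ℕ, ‖(k : L)‖ = ‖(k : ℚ_[p])‖) : CharZero L :=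
  charZero_of_inj_zero fun k hk ↦ by
    have := hL k
    rw [hk, norm_zero, eq_comm, norm_eq_zero] at this
    exact_mod_cast this

lemma norm_natCast_le_one_of_padic (hL : ∀ k : ℕ, ‖(k : L)‖ = ‖(k : ℚ_[p])‖) (k : ℕ) :
    ‖(k : L)‖ ≤ 1 := by
  rw [hL]
  exact_mod_cast Padic.norm_int_le_one (p := p) k

lemma norm_natCast_eq_one_of_not_dvd (hL : ∀ k : ℕ, ‖(k : L)‖ = ‖(k : ℚ_[p])‖) {k : ℕ}
    (hk : ¬ p ∣ k) : ‖(k : L)‖ = 1 := by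
  rw [hL, Padic.norm_natCast_eq_one_iff]
  exact (Nat.Prime.coprime_iff_not_dvd Fact.out).2 hk

lemma norm_pow_prime_sub_one (hL : ∀ k : ℕ, ‖(k : L)‖ = ‖(k : ℚ_[p])‖) {γ : L}
    (hγ : γ ^ (p - 1) = -(p : L)) : ‖γ‖ ^ (p - 1) = (p : ℝ)⁻¹ := by
  rw [← norm_pow, hγ, norm_neg, hL, Padic.norm_p]

lemma norm_pow_div_factorial_le (hL : ∀ k : ℕ, ‖(k : L)‖ = ‖(k : ℚ_[p])‖) {γ : L}
    (hγ : γ ^ (p - 1) = -(p : L)) {n : ℕ} (hn : n ≠ 0) :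
    ‖γ ^ n / (n.factorial : L)‖ ≤ ‖γ‖ := by
  have := charZero_of_norm_natCast hL
  have hp : p.Prime := Fact.out
  have hfac : ‖(n.factorial : L)‖ = (p : ℝ)⁻¹ ^ padicValNat p n.factorial := by
    rw [hL, Padic.norm_eq_zpow_neg_valuation (by exact_mod_cast n.factorial_ne_zero),
      Padic.valuation_natCast, zpow_neg, zpow_natCast, inv_pow]
  have hp1 : (p : ℝ)⁻¹ ≤ 1 := inv_le_one_of_one_le₀ (by exact_mod_cast hp.one_le)
  rw [norm_div, norm_pow, div_le_iff₀ (norm_pos_iff.2 (Nat.cast_ne_zero.2 n.factorial_ne_zero)),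
    ← pow_le_pow_iff_left₀ (by positivity) (by positivity) (Nat.sub_ne_zero_of_lt hp.one_lt),
    mul_pow, norm_pow_prime_sub_one hL hγ, ← pow_mul, mul_comm n, pow_mul,
    norm_pow_prime_sub_one hL hγ, hfac, ← pow_mul, ← pow_succ']
  refine pow_le_pow_of_le_one (by positivity) hp1 ?_
  rw [mul_comm]
  exact sub_one_mul_padicValNat_factorial_lt_of_ne_zero p hn

lemma norm_pow_div_factorial_le_one (hL : ∀ k : ℕ, ‖(k : L)‖ = ‖(k : ℚ_[p])‖) {γ : L}
    (hγ : γ ^ (p - 1) = -(p : L)) (hγ1 : ‖γ‖ ≤ 1) (n : ℕ) :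
    ‖γ ^ n / (n.factorial : L)‖ ≤ 1 := by
  rcases eq_or_ne n 0 with rfl | hn
  · simp
  · exact (norm_pow_div_factorial_le hL hγ hn).trans hγ1

lemma norm_sub_le_max_norm {G : Type*} [SeminormedAddGroup G] [IsUltrametricDist G] (x y : G) :
    ‖x - y‖ ≤ max ‖x‖ ‖y‖ := by
  simpa only [sub_eq_add_neg, norm_neg] using IsUltrametricDist.norm_add_le_max x (-y)

lemma norm_le_of_dwork_recurrence [IsUltrametricDist L]
    (hL : ∀ k : ℕ, ‖(k : L)‖ = ‖(k : ℚ_[p])‖) {c : ℕ → ℕ → L} {ρ : ℝ} (hρ0 : 0 ≤ ρ)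
    (hρ1 : ρ ≤ 1) (hρ : ρ ^ 2 = (p : ℝ)⁻¹) (h00 : c 0 0 = 1)
    (h0 : ∀ r, r + 1 < p → (r + 1 : L) * c 0 (r + 1) = c 0 r)
    (h1 : ∀ m, c (m + 1) 0 = c m 0 + c m (p - 1))
    (h2 : ∀ m r : ℕ, r + 1 < p → (p * (m + 1) + (r + 1) : L) * c (m + 1) (r + 1) =
      c (m + 1) r + p * (m + 1) * c m (r + 1)) (m : ℕ) :
    (∀ r < p, ‖c m r‖ ≤ ρ ^ m) ∧
      ∀ r < p, ‖c m r * (r.factorial : L) - c m 0‖ ≤ ρ ^ (m + 1) := by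
  have hp : p.Prime := Fact.out
  have hnorm_p : ‖(p : L)‖ = ρ ^ 2 := by rw [hL, Padic.norm_p, hρ]
  have hint (k : ℕ) : ‖(k : L)‖ ≤ 1 := norm_natCast_le_one_of_padic hL k
  induction m with
  | zero =>
    have key : ∀ r < p, c 0 r * (r.factorial : L) = 1 := by
      intro r
      induction r with
      | zero => simp [h00]
      | succ r ih =>
        intro hr
        rw [Nat.factorial_succ, ← ih (by omega), ← h0 r hr]
        push_cast
        ring
    refine ⟨fun r hr ↦ ?_, fun r hr ↦ ?_⟩
    · have hfac : ‖(r.factorial : L)‖ = 1 :=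
        norm_natCast_eq_one_of_not_dvd hL fun h ↦ (not_le.2 hr) ((hp.dvd_factorial).1 h)
      have := congrArg norm (key r hr)
      rw [norm_mul, hfac, mul_one, norm_one] at this
      rw [this, pow_zero]
    · rw [key r hr, h00, sub_self, norm_zero]
      positivity
  | succ m ih =>
    obtain ⟨ihc, ihd⟩ := ih
    have hpmul {x : L} (hx : ‖x‖ ≤ ρ ^ m) (k : ℕ) : ‖(p : L) * k * x‖ ≤ ρ ^ (m + 2) := by
      rw [norm_mul, norm_mul, hnorm_p, pow_add, mul_comm]
      refine mul_le_mul hx ?_ (by positivity) (by positivity)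
      exact mul_le_of_le_one_right (by positivity) (hint k)
    have hstep : ρ ^ (m + 2) ≤ ρ ^ (m + 1) := pow_le_pow_of_le_one hρ0 hρ1 (by omega)
    have hzero : ‖c (m + 1) 0‖ ≤ ρ ^ (m + 1) := by
      obtain ⟨t, ht⟩ : p ∣ (p - 1).factorial + 1 := by
        rw [← ZMod.natCast_eq_zero_iff, Nat.cast_add, ZMod.wilsons_lemma]
        simp
      have ht' : ((p - 1).factorial : L) = p * t - 1 := by
        rw [eq_sub_iff_add_eq]
        exact_mod_cast congrArg (Nat.cast (R := L)) ht
      have : c (m + 1) 0 = (p : L) * t * c m (p - 1) -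
          (c m (p - 1) * ((p - 1).factorial : L) - c m 0) := by
        rw [h1, ht']
        ring
      have hlt : p - 1 < p := Nat.sub_lt hp.pos one_pos
      rw [this]
      exact (norm_sub_le_max_norm _ _).trans
        (max_le ((hpmul (ihc _ hlt) t).trans hstep) (ihd _ hlt))
    have hc : ∀ r < p, ‖c (m + 1) r‖ ≤ ρ ^ (m + 1) := by
      intro r
      induction r with
      | zero => exact fun _ ↦ hzero
      | succ r ih =>
        intro hr
        have hunit : ‖(p * (m + 1) + (r + 1) : L)‖ = 1 := by
          have := norm_natCast_eq_one_of_not_dvd (k := p * (m + 1) + (r + 1)) hL fun h ↦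
            Nat.not_dvd_of_pos_of_lt r.succ_pos hr ((Nat.dvd_add_right (dvd_mul_right _ _)).1 h)
          exact_mod_cast this
        have := congrArg norm (h2 m r hr)
        rw [norm_mul, hunit, one_mul] at this
        rw [this]
        refine (IsUltrametricDist.norm_add_le_max _ _).trans (max_le (ih (by omega)) ?_)
        exact_mod_cast (hpmul (ihc _ hr) (m + 1)).trans hstep
    refine ⟨hc, fun r ↦ ?_⟩
    induction r with
    | zero => simpa using fun _ ↦ pow_nonneg hρ0 _
    | succ r ih =>
      intro hr
      have : c (m + 1) (r + 1) * ((r + 1).factorial : L) - c (m + 1) 0 =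
          (c (m + 1) r * (r.factorial : L) - c (m + 1) 0) +
            p * ((m + 1) * r.factorial : ℕ) * (c m (r + 1) - c (m + 1) (r + 1)) := by
        rw [Nat.factorial_succ]
        push_cast
        linear_combination (r.factorial : L) * h2 m r hr
      rw [this]
      refine (IsUltrametricDist.norm_add_le_max _ _).trans (max_le (ih (by omega)) (hpmul ?_ _))
      refine (norm_sub_le_max_norm _ _).trans (max_le (ihc _ hr) ((hc _ hr).trans ?_))
      exact pow_le_pow_of_le_one hρ0 hρ1 (by omega)

end Estimates

section Dwork

open PowerSeries

variable {p : ℕ} [Fact p.Prime] {L : Type*} [NormedField L]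

/-- The factor `q` in `e_{pm+r} = γ^r · ((-γ)^m / m!) · q`. -/
noncomputable def dworkQuot (L : Type*) [Field L] (p : ℕ) (γ : L) (m r : ℕ) : L :=
  dworkCoeff L p γ (p * m + r) * m.factorial / (γ ^ r * (-γ) ^ m)

lemma ne_zero_of_pow_prime_sub_one (hL : ∀ k : ℕ, ‖(k : L)‖ = ‖(k : ℚ_[p])‖) {γ : L}
    (hγ : γ ^ (p - 1) = -(p : L)) : γ ≠ 0 := by
  have := charZero_of_norm_natCast hL
  have hp : p.Prime := Fact.out
  rintro rfl
  rw [zero_pow (Nat.sub_ne_zero_of_lt hp.one_lt), eq_comm, neg_eq_zero, Nat.cast_eq_zero] at hγ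
  exact hp.ne_zero hγ

lemma norm_lt_one_of_pow_prime_sub_one (hL : ∀ k : ℕ, ‖(k : L)‖ = ‖(k : ℚ_[p])‖) {γ : L}
    (hγ : γ ^ (p - 1) = -(p : L)) : ‖γ‖ < 1 := by
  have hp : p.Prime := Fact.out
  rw [← pow_lt_one_iff_of_nonneg (norm_nonneg γ) (Nat.sub_ne_zero_of_lt hp.one_lt),
    norm_pow_prime_sub_one hL hγ]
  exact inv_lt_one_of_one_lt₀ (by exact_mod_cast hp.one_lt)

lemma dworkCoeff_eq_mul_dworkQuot {L : Type*} [Field L] [CharZero L] {p : ℕ} {γ : L} (hγ0 : γ ≠ 0)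
    (m r : ℕ) : dworkCoeff L p γ (p * m + r) =
      γ ^ r * (-γ) ^ m / m.factorial * dworkQuot L p γ m r := by
  have h1 := pow_ne_zero r hγ0
  have h2 := pow_ne_zero m (neg_ne_zero.2 hγ0)
  have h3 : (m.factorial : L) ≠ 0 := Nat.cast_ne_zero.2 m.factorial_ne_zero
  rw [dworkQuot]
  field_simp

lemma norm_dworkQuot_le [IsUltrametricDist L] (hL : ∀ k : ℕ, ‖(k : L)‖ = ‖(k : ℚ_[p])‖)
    {γ : L} (hγ : γ ^ (p - 1) = -(p : L)) (m : ℕ) {r : ℕ} (hr : r < p) :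
    ‖dworkQuot L p γ m r‖ ≤ √(p : ℝ)⁻¹ ^ m := by
  have := charZero_of_norm_natCast hL
  have hp : p.Prime := Fact.out
  have hpL : (p : L) ≠ 0 := Nat.cast_ne_zero.2 hp.ne_zero
  have hγ0 : γ ≠ 0 := ne_zero_of_pow_prime_sub_one hL hγ
  have hfac (k : ℕ) : (k.factorial : L) ≠ 0 := Nat.cast_ne_zero.2 k.factorial_ne_zero
  have hcoeff := dworkCoeff_eq_mul_dworkQuot (p := p) hγ0
  refine (norm_le_of_dwork_recurrence (c := dworkQuot L p γ) hL (Real.sqrt_nonneg _) ?_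
    (Real.sq_sqrt (by positivity)) ?_ ?_ ?_ ?_ m).1 r hr
  · exact Real.sqrt_le_one.2 (inv_le_one_of_one_le₀ (by exact_mod_cast hp.one_le))
  · simp [dworkQuot, dworkCoeff]
  · intro r hr
    have h := dworkCoeff_succ γ hp.ne_zero r
    rw [if_neg (by omega)] at h
    have e1 := hcoeff 0 r
    have e2 := hcoeff 0 (r + 1)
    simp only [mul_zero, zero_add, pow_zero, mul_one, Nat.factorial_zero, Nat.cast_one,
      div_one] at e1 e2
    rw [e1, e2] at h
    refine mul_left_cancel₀ (pow_ne_zero (r + 1) hγ0) ?_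
    linear_combination h
  · intro m
    have h := dworkCoeff_succ γ hp.ne_zero (p * m + (p - 1))
    have i1 : p * m + (p - 1) + 1 = p * (m + 1) + 0 := by
      have := hp.one_le
      rw [mul_add]
      omega
    have i2 : p * m + (p - 1) - (p - 1) = p * m + 0 := by omega
    have i3 : ((p * m + (p - 1) : ℕ) : L) + 1 = p * (m + 1) := by exact_mod_cast i1
    rw [if_pos (by omega), i1, i2, i3, hcoeff, hcoeff, hcoeff, hγ, Nat.factorial_succ] at h
    have h1 := hfac m
    have h2 : (m : L) + 1 ≠ 0 := Nat.cast_add_one_ne_zero m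
    have h3 := pow_ne_zero (m + 1) (neg_ne_zero.2 hγ0)
    push_cast at h
    field_simp at h
    refine mul_left_cancel₀ h3 ?_
    linear_combination h
  · intro m r hr
    have h := dworkCoeff_succ γ hp.ne_zero (p * (m + 1) + r)
    have i2 : p * (m + 1) + r - (p - 1) = p * m + (r + 1) := by
      have := hp.one_le
      rw [mul_add]
      omega
    have i4 : p - 1 ≤ p * (m + 1) + r := by
      rw [mul_add]
      omega
    rw [if_pos i4, i2, add_assoc, hcoeff, hcoeff, hcoeff, Nat.factorial_succ] at h
    have h1 := hfac m
    have h2 : (m : L) + 1 ≠ 0 := Nat.cast_add_one_ne_zero m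
    have h3 := pow_ne_zero (m + 1) (neg_ne_zero.2 hγ0)
    have h4 := pow_ne_zero (r + 1) hγ0
    push_cast at h
    field_simp at h
    refine mul_left_cancel₀ (mul_ne_zero h4 h3) ?_
    linear_combination h

lemma norm_dworkCoeff_le [IsUltrametricDist L] (hL : ∀ k : ℕ, ‖(k : L)‖ = ‖(k : ℚ_[p])‖)
    {γ : L} (hγ : γ ^ (p - 1) = -(p : L)) (n : ℕ) :
    ‖dworkCoeff L p γ n‖ ≤
      ‖γ‖ ^ (n % p) * ‖γ ^ (n / p) / ((n / p).factorial : L)‖ * √(p : ℝ)⁻¹ ^ (n / p) := by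
  have := charZero_of_norm_natCast hL
  have hp : p.Prime := Fact.out
  conv_lhs => rw [← Nat.div_add_mod n p,
    dworkCoeff_eq_mul_dworkQuot (ne_zero_of_pow_prime_sub_one hL hγ), mul_div_assoc]
  rw [norm_mul, norm_mul, norm_pow, norm_div, norm_div, norm_pow, norm_pow, norm_neg]
  gcongr
  exact norm_dworkQuot_le hL hγ _ (Nat.mod_lt _ hp.pos)

lemma summable_pow_div {ρ : ℝ} (hρ0 : 0 < ρ) (hρ1 : ρ < 1) {k : ℕ} (hk : k ≠ 0) :
    Summable fun n : ℕ ↦ ρ ^ (n / k) := by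
  set σ : ℝ := ρ ^ (k⁻¹ : ℝ)
  have hσ : σ ^ k = ρ := Real.rpow_inv_natCast_pow hρ0.le hk
  have hσ0 : 0 < σ := Real.rpow_pos_of_pos hρ0 _
  have hσ1 : σ < 1 := by rwa [← pow_lt_one_iff_of_nonneg hσ0.le hk, hσ]
  refine .of_nonneg_of_le (fun n ↦ by positivity) (fun n ↦ ?_)
    ((summable_geometric_of_lt_one hσ0.le hσ1).div_const ρ)
  rw [le_div_iff₀ hρ0, ← pow_succ, ← hσ, ← pow_mul]
  exact pow_le_pow_of_le_one hσ0.le hσ1.le (Nat.lt_mul_div_succ n (Nat.pos_of_ne_zero hk)).le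

lemma summable_norm_dworkCoeff [IsUltrametricDist L]
    (hL : ∀ k : ℕ, ‖(k : L)‖ = ‖(k : ℚ_[p])‖) {γ : L} (hγ : γ ^ (p - 1) = -(p : L)) :
    Summable fun n ↦ ‖dworkCoeff L p γ n‖ := by
  have hp : p.Prime := Fact.out
  have hp1 : (p : ℝ)⁻¹ < 1 := inv_lt_one_of_one_lt₀ (by exact_mod_cast hp.one_lt)
  have hp0 : 0 < (p : ℝ)⁻¹ := inv_pos.2 (by exact_mod_cast hp.pos)
  have hγ1 : ‖γ‖ ≤ 1 := (norm_lt_one_of_pow_prime_sub_one hL hγ).le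
  refine .of_nonneg_of_le (fun n ↦ norm_nonneg _) (fun n ↦ ?_)
    (summable_pow_div (Real.sqrt_pos.2 hp0) (by rwa [Real.sqrt_lt' one_pos, one_pow]) hp.ne_zero)
  refine (norm_dworkCoeff_le hL hγ n).trans (mul_le_of_le_one_left (by positivity) ?_)
  exact mul_le_one₀ (pow_le_one₀ (norm_nonneg _) hγ1) (norm_nonneg _)
    (norm_pow_div_factorial_le_one hL hγ hγ1 _)

lemma norm_dworkCoeff_add_two_le [IsUltrametricDist L]
    (hL : ∀ k : ℕ, ‖(k : L)‖ = ‖(k : ℚ_[p])‖) {γ : L} (hγ : γ ^ (p - 1) = -(p : L)) (n : ℕ) :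
    ‖dworkCoeff L p γ (n + 2)‖ ≤ ‖γ‖ * max ‖γ‖ √(p : ℝ)⁻¹ := by
  have hp : p.Prime := Fact.out
  have hp1 : (p : ℝ)⁻¹ ≤ 1 := inv_le_one_of_one_le₀ (by exact_mod_cast hp.one_le)
  have hγ1 : ‖γ‖ ≤ 1 := (norm_lt_one_of_pow_prime_sub_one hL hγ).le
  refine (norm_dworkCoeff_le hL hγ _).trans ?_
  rcases eq_or_ne ((n + 2) / p) 0 with h | h
  · have hlt : n + 2 < p := (Nat.div_eq_zero_iff_lt hp.pos).1 h
    rw [h, Nat.mod_eq_of_lt hlt, pow_zero, pow_zero, Nat.factorial_zero, Nat.cast_one, div_one,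
      norm_one, mul_one, mul_one]
    calc ‖γ‖ ^ (n + 2) ≤ ‖γ‖ ^ 2 := pow_le_pow_of_le_one (norm_nonneg _) hγ1 (by omega)
      _ = ‖γ‖ * ‖γ‖ := sq _
      _ ≤ _ := by gcongr; exact le_max_left _ _
  · refine mul_le_mul ?_ ?_ (by positivity) (norm_nonneg _)
    · exact (mul_le_of_le_one_left (norm_nonneg _) (pow_le_one₀ (norm_nonneg _) hγ1)).trans
        (norm_pow_div_factorial_le hL hγ h)
    · exact (pow_le_of_le_one (Real.sqrt_nonneg _) (Real.sqrt_le_one.2 hp1) h).trans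
        (le_max_right _ _)

lemma tsum_dworkCoeff_ne_one [CompleteSpace L] [IsUltrametricDist L]
    (hL : ∀ k : ℕ, ‖(k : L)‖ = ‖(k : ℚ_[p])‖) {γ : L} (hγ : γ ^ (p - 1) = -(p : L)) :
    ∑' n, dworkCoeff L p γ n ≠ 1 := by
  have hp : p.Prime := Fact.out
  have hp1 : (p : ℝ)⁻¹ < 1 := inv_lt_one_of_one_lt₀ (by exact_mod_cast hp.one_lt)
  have hγ1 : ‖γ‖ < 1 := norm_lt_one_of_pow_prime_sub_one hL hγ
  have hγ0 : 0 < ‖γ‖ := norm_pos_iff.2 (ne_zero_of_pow_prime_sub_one hL hγ)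
  have h0 : dworkCoeff L p γ 0 = 1 := by simp [dworkCoeff]
  have h1 : dworkCoeff L p γ 1 = γ := by simp [dworkCoeff, Nat.div_eq_of_lt hp.one_lt]
  intro h
  have hsum := (summable_norm_dworkCoeff hL hγ).of_norm.sum_add_tsum_nat_add 2
  rw [h, Finset.sum_range_succ, Finset.sum_range_one, h0, h1, add_assoc, add_eq_left] at hsum
  have hle := IsUltrametricDist.norm_tsum_le_of_forall_le (norm_dworkCoeff_add_two_le hL hγ)
  rw [← neg_eq_of_add_eq_zero_right hsum, norm_neg] at hle
  refine hle.not_gt (mul_lt_of_lt_one_right hγ0 (max_lt hγ1 ?_))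
  rwa [Real.sqrt_lt' one_pos, one_pow]

lemma summable_norm_coeff_rescale_exp [Algebra ℚ L]
    (hL : ∀ k : ℕ, ‖(k : L)‖ = ‖(k : ℚ_[p])‖) {γ : L} (hγ : γ ^ (p - 1) = -(p : L)) {a : L}
    (ha : ‖a‖ = ‖p * γ‖) : Summable fun n ↦ ‖coeff n (rescale a (exp L))‖ := by
  have hp : p.Prime := Fact.out
  have hp1 : ‖(p : L)‖ < 1 := by
    rw [hL, Padic.norm_p]
    exact inv_lt_one_of_one_lt₀ (by exact_mod_cast hp.one_lt)
  refine .of_nonneg_of_le (fun n ↦ norm_nonneg _) (fun n ↦ ?_)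
    (summable_geometric_of_lt_one (norm_nonneg _) hp1)
  rw [coeff_rescale_exp, norm_div, norm_pow, ha, ← norm_pow, ← norm_div, mul_pow, mul_div_assoc,
    norm_mul, norm_pow]
  exact mul_le_of_le_one_right (by positivity)
    (norm_pow_div_factorial_le_one hL hγ (norm_lt_one_of_pow_prime_sub_one hL hγ).le n)

lemma tsum_dworkCoeff_pow [CompleteSpace L] [IsUltrametricDist L] [Algebra ℚ L]
    (hL : ∀ k : ℕ, ‖(k : L)‖ = ‖(k : ℚ_[p])‖) {γ : L} (hγ : γ ^ (p - 1) = -(p : L)) :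
    (∑' n, dworkCoeff L p γ n) ^ p = 1 := by
  have hp : p ≠ 0 := (Fact.out : p.Prime).ne_zero
  have hE := summable_norm_dworkCoeff hL hγ
  simp only [← coeff_dworkSeries γ hp] at hE ⊢
  have hA := summable_norm_coeff_rescale_exp hL hγ rfl
  have hB := summable_norm_coeff_rescale_exp hL hγ (norm_neg (p * γ))
  rw [← tsum_coeff_pow hE, dworkSeries_pow, tsum_coeff_mul hA (summable_norm_coeff_expand hB hp),
    tsum_coeff_expand, ← tsum_coeff_mul hA hB, exp_mul_exp_eq_exp_add, add_neg_cancel,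
    rescale_zero_apply]
  simp

end Dwork

/-- The value `E_γ(1) = Σ_{n ≥ 0} e_n` of Dwork's power series at `1` exists and is a
primitive `p`-th root of unity in `L`. -/
theorem dworkSeries_one_isPrimitiveRoot
    (p : ℕ) [Fact p.Prime] (L : Type*) [NormedField L] [CompleteSpace L]
    [Algebra ℚ_[p] L] (hnorm : ∀ q : ℚ_[p], ‖algebraMap ℚ_[p] L q‖ = ‖q‖)
    (γ : L) (hγ : γ ^ (p - 1) = -(p : L)) :
    (Summable fun n : ℕ => dworkCoeff L p γ n) ∧
    IsPrimitiveRoot (∑' n : ℕ, dworkCoeff L p γ n) p := by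
  have hL (k : ℕ) : ‖(k : L)‖ = ‖(k : ℚ_[p])‖ := by rw [← hnorm, map_natCast]
  have := charZero_of_norm_natCast hL
  have : IsUltrametricDist L :=
    IsUltrametricDist.isUltrametricDist_of_forall_norm_natCast_le_one
      (norm_natCast_le_one_of_padic hL)
  refine ⟨(summable_norm_dworkCoeff hL hγ).of_norm, ?_⟩
  have horder := orderOf_eq_prime (tsum_dworkCoeff_pow hL hγ) (tsum_dworkCoeff_ne_one hL hγ)
  simpa only [horder] using IsPrimitiveRoot.orderOf (∑' n, dworkCoeff L p γ n)
end
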